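/- Let Γ = ⟨x, y ∣ x² = y³⟩ be the trefoil knot group, ω = e^{2πi/3}, and for (s, t) ∈ ℂ² let ρ_{s,t}: Γ → SL₃(ℂ) be the representation with ρ_{s,t}(x) = [[1, 0, 0], [s, −1, 0], [t, 0, −1]] and ρ_{s,t}(y) = [[1, ω − 1, ω² − 1], [0, ω, 0], [0, 0, ω²]]. Then every irreducible representation ρ: Γ → SL₃(ℂ) is conjugate in SL₃(ℂ) to ρ_{s,t} for some (s, t) ∈ ℂ². -/

import Mathlib

/-- The single relator `x² y⁻³` of the trefoil knot group. -/
def trefoilRels : Set (FreeGroup Bool) := {FreeGroup.of true ^ 2 * (FreeGroup.of false ^ 3)⁻¹}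

/-- The trefoil knot group `⟨x, y ∣ x² = y³⟩`. -/
abbrev TrefoilGroup := PresentedGroup trefoilRels

/-- The generator `x`. -/
def trefX : TrefoilGroup := PresentedGroup.of true

/-- The generator `y`. -/
def trefY : TrefoilGroup := PresentedGroup.of false

/-- `ω = e^{2πi/3}`, a primitive cube root of unity. -/
noncomputable def omg : ℂ := Complex.exp (2 * Real.pi * Complex.I / 3)

theorem omg_isPrimitiveRoot : IsPrimitiveRoot omg 3 := by
  simpa [omg] using Complex.isPrimitiveRoot_exp 3 (by norm_num)

theorem trefoil_relation : trefX ^ 2 = trefY ^ 3 :=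
  PresentedGroup.mk_eq_mk_of_mul_inv_mem (rels := trefoilRels) rfl

theorem closure_trefX_trefY : Subgroup.closure {trefX, trefY} = ⊤ := by
  rw [eq_top_iff, ← PresentedGroup.closure_range_of, Subgroup.closure_le]
  rintro _ ⟨b, rfl⟩
  cases b
  · exact Subgroup.subset_closure (by simp [trefY])
  · exact Subgroup.subset_closure (by simp [trefX])

/-- `x² = y³` is central in the trefoil group. -/
theorem trefX_sq_commute (γ : TrefoilGroup) : Commute (trefX ^ 2) γ := by
  have hγ : γ ∈ Subgroup.closure {trefX, trefY} := by simp [closure_trefX_trefY]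
  induction hγ using Subgroup.closure_induction with
  | mem z hz =>
    rcases hz with rfl | rfl
    · exact Commute.pow_self _ _
    · rw [trefoil_relation]
      exact Commute.pow_self _ _
  | one => exact Commute.one_right _
  | mul a b _ _ ha hb => exact ha.mul_right hb
  | inv a _ ha => exact ha.inv_right

theorem trefoil_hom_ext {G : Type*} [Group G] {φ ψ : TrefoilGroup →* G}
    (hx : φ trefX = ψ trefX) (hy : φ trefY = ψ trefY) : φ = ψ :=
  PresentedGroup.ext fun b => by cases b <;> assumption

/-- An eigenvector of the images of both generators is an eigenvector of the whole group. -/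
theorem exists_mulVec_eq_smul {n : Type*} [Fintype n] [DecidableEq n]
    (ρ : TrefoilGroup →* Matrix.SpecialLinearGroup n ℂ) {v : n → ℂ} (hv : v ≠ 0) {a b : ℂ}
    (hx : (ρ trefX : Matrix n n ℂ).mulVec v = a • v)
    (hy : (ρ trefY : Matrix n n ℂ).mulVec v = b • v) (γ : TrefoilGroup) :
    ∃ c : ℂ, (ρ γ : Matrix n n ℂ).mulVec v = c • v := by
  have hγ : γ ∈ Subgroup.closure {trefX, trefY} := by simp [closure_trefX_trefY]
  induction hγ using Subgroup.closure_induction with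
  | mem z hz =>
    rcases hz with rfl | rfl
    · exact ⟨a, hx⟩
    · exact ⟨b, hy⟩
  | one => exact ⟨1, by simp⟩
  | mul p q _ _ hp hq =>
    obtain ⟨c, hc⟩ := hp
    obtain ⟨d, hd⟩ := hq
    exact ⟨d * c, by
      rw [map_mul, Matrix.SpecialLinearGroup.coe_mul, ← Matrix.mulVec_mulVec, hd,
        Matrix.mulVec_smul, hc, smul_smul]⟩
  | inv p _ hp =>
    obtain ⟨c, hc⟩ := hp
    have key : v = c • (ρ p⁻¹ : Matrix n n ℂ).mulVec v := by
      rw [← Matrix.mulVec_smul, ← hc, Matrix.mulVec_mulVec,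
        ← Matrix.SpecialLinearGroup.coe_mul, ← map_mul]
      simp
    have hc0 : c ≠ 0 := by
      rintro rfl
      exact hv (by simpa using key)
    exact ⟨c⁻¹, by rw [eq_inv_smul_iff₀ hc0]; exact key.symm⟩

/-- Schur's lemma for matrix representations. -/
theorem eq_smul_one_of_commute {G n : Type*} [Group G] [Fintype n] [DecidableEq n] [Nonempty n]
    (ρ : G →* Matrix.SpecialLinearGroup n ℂ)
    (hirr : ∀ W : Submodule ℂ (n → ℂ),
      (∀ γ : G, ∀ v ∈ W, (ρ γ : Matrix n n ℂ).mulVec v ∈ W) → W = ⊥ ∨ W = ⊤)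
    (Z : Matrix n n ℂ) (hZ : ∀ γ, Commute Z (ρ γ : Matrix n n ℂ)) :
    ∃ c : ℂ, ∀ v, Z.mulVec v = c • v := by
  obtain ⟨c, hc⟩ := Module.End.exists_eigenvalue (Matrix.toLin' Z)
  refine ⟨c, ?_⟩
  have htop : Module.End.eigenspace (Matrix.toLin' Z) c = ⊤ := by
    refine (hirr _ fun γ v hv => ?_).resolve_left hc
    rw [Module.End.mem_eigenspace_iff, Matrix.toLin'_apply] at hv ⊢
    rw [Matrix.mulVec_mulVec, (hZ γ).eq, ← Matrix.mulVec_mulVec, hv, Matrix.mulVec_smul]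
  intro v
  have : v ∈ Module.End.eigenspace (Matrix.toLin' Z) c := htop ▸ Submodule.mem_top
  rwa [Module.End.mem_eigenspace_iff, Matrix.toLin'_apply] at this

section LinearAlgebra

open Module

variable {K V : Type*} [Field K] [AddCommGroup V] [Module K V]

theorem finrank_le_one_of_dual_ne_zero (φ : V →ₗ[K] K) (W : Submodule K V)
    (h : ∀ v ∈ W, v ≠ 0 → φ v ≠ 0) : finrank K W ≤ 1 := by
  have hinj : Function.Injective (φ ∘ₗ W.subtype) := by
    rw [injective_iff_map_eq_zero]
    intro v hv
    by_contra h0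
    exact h v v.2 (by simpa using h0) hv
  simpa using LinearMap.finrank_le_finrank_of_injective hinj

variable [FiniteDimensional K V]

theorem finrank_range_le_finrank_ker_of_comp_eq_zero {f g : V →ₗ[K] V} (h : f ∘ₗ g = 0) :
    finrank K (LinearMap.range g) ≤ finrank K (LinearMap.ker f) :=
  Submodule.finrank_mono (LinearMap.range_le_ker_iff.2 h)

/-- If `f` and `g` have at most one-dimensional kernels and `f g h = 0` on a three-dimensional
space, then `h` has nontrivial kernel. -/
theorem exists_ne_zero_of_comp_eq_zero (hV : finrank K V = 3) {f g h : V →ₗ[K] V}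
    (hfgh : ∀ v, f (g (h v)) = 0) (hf : finrank K (LinearMap.ker f) ≤ 1)
    (hg : finrank K (LinearMap.ker g) ≤ 1) : ∃ v ≠ 0, h v = 0 := by
  by_contra! hinj
  have hker : LinearMap.ker h = ⊥ :=
    (Submodule.eq_bot_iff _).2 fun v hv => by_contra fun h0 => hinj v h0 hv
  have hsurj : Function.Surjective h :=
    LinearMap.injective_iff_surjective.1 (LinearMap.ker_eq_bot.1 hker)
  have hfg : f ∘ₗ g = 0 := by
    ext v
    obtain ⟨w, rfl⟩ := hsurj v
    exact hfgh w
  have h1 := finrank_range_le_finrank_ker_of_comp_eq_zero hfg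
  have h2 := LinearMap.finrank_range_add_finrank_ker g
  omega

/-- An endomorphism whose square is a scalar acts, on a three-dimensional space, as a rank at most
one perturbation of a scalar. -/
theorem exists_rank_add_smul_le_one (hV : finrank K V = 3) (f : V →ₗ[K] V) (a : K)
    (hf : ∀ v, f (f v) = a ^ 2 • v) :
    ∃ b : K, b ^ 2 = a ^ 2 ∧ finrank K (LinearMap.range (f + b • LinearMap.id)) ≤ 1 := by
  have hcomp : (f - a • LinearMap.id) ∘ₗ (f + a • LinearMap.id) = 0 := by
    ext v
    simp only [LinearMap.comp_apply, LinearMap.sub_apply, LinearMap.add_apply, map_add, map_smul,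
      LinearMap.smul_apply, LinearMap.id_apply, hf, LinearMap.zero_apply]
    module
  have h1 := finrank_range_le_finrank_ker_of_comp_eq_zero hcomp
  have h2 := LinearMap.finrank_range_add_finrank_ker (f - a • LinearMap.id)
  by_cases h : finrank K (LinearMap.range (f + a • LinearMap.id)) ≤ 1
  · exact ⟨a, rfl, h⟩
  · refine ⟨-a, by ring, ?_⟩
    rw [neg_smul, ← sub_eq_add_neg]
    omega

/-- A linear map of rank at most one has the form `v ↦ φ v • u`. -/
theorem exists_dual_smul_of_finrank_range_le_one (f : V →ₗ[K] V)
    (hf : finrank K (LinearMap.range f) ≤ 1) (hf0 : f ≠ 0) :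
    ∃ (u : V) (φ : V →ₗ[K] K), u ≠ 0 ∧ u ∈ LinearMap.range f ∧ ∀ v, f v = φ v • u := by
  obtain ⟨w, hw⟩ : ∃ w, f w ≠ 0 := by
    by_contra! h
    exact hf0 (LinearMap.ext h)
  obtain ⟨ψ, hψ⟩ := Projective.exists_dual_eq_one K hw
  obtain ⟨⟨z, hz⟩, hspan⟩ := finrank_le_one_iff.1 hf
  have hsp : ∀ v, ∃ c : K, c • z = f v := fun v => by
    obtain ⟨c, hc⟩ := hspan ⟨f v, v, rfl⟩
    exact ⟨c, congrArg Subtype.val hc⟩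
  refine ⟨f w, ψ ∘ₗ f, hw, ⟨w, rfl⟩, fun v => ?_⟩
  obtain ⟨c, hc⟩ := hsp w
  obtain ⟨d, hd⟩ := hsp v
  rw [← hc, map_smul, smul_eq_mul] at hψ
  rw [LinearMap.comp_apply, ← hd, ← hc, map_smul, smul_eq_mul, smul_smul, mul_assoc,
    mul_comm (ψ z), hψ, mul_one]

/-- If `f³` is the scalar `p³` and the eigenspaces of `f` are at most one-dimensional, then `p` is
an eigenvalue of `f`. -/
theorem exists_eigenvector_of_cube (hV : finrank K V = 3) (f : V →ₗ[K] V) {w p : K}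
    (hw : 1 + w + w ^ 2 = 0) (hf : ∀ v, f (f (f v)) = p ^ 3 • v)
    (hker : ∀ b : K, finrank K (LinearMap.ker (f - b • LinearMap.id)) ≤ 1) :
    ∃ v ≠ 0, f v = p • v := by
  obtain ⟨v, hv, h⟩ := exists_ne_zero_of_comp_eq_zero hV (f := f - (p * w) • LinearMap.id)
    (g := f - (p * w ^ 2) • LinearMap.id) (h := f - p • LinearMap.id) (fun v => by
      simp only [LinearMap.sub_apply, map_sub, map_smul, LinearMap.smul_apply, LinearMap.id_apply,
        hf]
      match_scalars
      · linear_combination (1 - w) * p ^ 3 * hw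
      · linear_combination -p * hw
      · linear_combination p ^ 2 * w * hw) (hker _) (hker _)
  exact ⟨v, hv, sub_eq_zero.1 h⟩

end LinearAlgebra

/-- Eigenvectors with distinct eigenvalues diagonalize a matrix. -/
theorem Matrix.det_ne_zero_and_mul_eq_mul_diagonal {n : Type*} [Fintype n] [DecidableEq n]
    {K : Type*} [Field K] (A : Matrix n n K) (μ : n → K) (hμ : Function.Injective μ)
    (v : n → n → K) (hv0 : ∀ i, v i ≠ 0) (hv : ∀ i, A.mulVec (v i) = μ i • v i) :
    (Matrix.of v).transpose.det ≠ 0 ∧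
      A * (Matrix.of v).transpose = (Matrix.of v).transpose * Matrix.diagonal μ := by
  constructor
  · have hli : LinearIndependent K v :=
      Module.End.eigenvectors_linearIndependent' (Matrix.toLin' A) μ hμ v fun i =>
        ⟨by rw [Module.End.mem_eigenspace_iff, Matrix.toLin'_apply, hv], hv0 i⟩
    have hunit : IsUnit (Matrix.of v) := Matrix.linearIndependent_rows_iff_isUnit.1 hli
    rw [Matrix.det_transpose]
    exact ((Matrix.isUnit_iff_isUnit_det _).1 hunit).ne_zero
  · ext i j
    rw [Matrix.mul_diagonal]
    have := congrFun (hv j) i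
    simpa [Matrix.mulVec, dotProduct, Matrix.mul_apply, mul_comm] using this

/-- An invertible intertwiner can be rescaled to one of determinant one. -/
theorem exists_specialLinearGroup_conj {n : Type*} [Fintype n] [DecidableEq n] [Nonempty n]
    (G : Matrix n n ℂ) (hG : G.det ≠ 0) :
    ∃ g : Matrix.SpecialLinearGroup n ℂ, ∀ A B : Matrix.SpecialLinearGroup n ℂ,
      (A : Matrix n n ℂ) * G = G * B → A = g * B * g⁻¹ := by
  obtain ⟨r, hr⟩ := IsAlgClosed.exists_pow_nat_eq (G.det)⁻¹ (Fintype.card_pos (α := n))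
  let g : Matrix.SpecialLinearGroup n ℂ :=
    ⟨r • G, by rw [Matrix.det_smul, hr, inv_mul_cancel₀ hG]⟩
  refine ⟨g, fun A B h => ?_⟩
  rw [eq_mul_inv_iff_mul_eq]
  have hg : (g : Matrix n n ℂ) = r • G := rfl
  apply Subtype.ext
  rw [Matrix.SpecialLinearGroup.coe_mul, Matrix.SpecialLinearGroup.coe_mul, hg, Matrix.mul_smul, h,
    Matrix.smul_mul]

/-- **Section 9 (used in Theorem 9.10).** Let `ρ_{s,t} : Γ → SL₃(ℂ)` be the family of
representations of the trefoil knot group with `ρ_{s,t}(x) = [[1,0,0],[s,-1,0],[t,0,-1]]` and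
`ρ_{s,t}(y) = [[1, ω-1, ω²-1],[0, ω, 0],[0, 0, ω²]]`.  Then every irreducible representation
`ρ : Γ → SL₃(ℂ)` is conjugate in `SL₃(ℂ)` to `ρ_{s,t}` for some `(s, t) ∈ ℂ²`. -/
theorem trefoil_SL3_irreducible_conjugate_to_family
    (P : ℂ → ℂ → TrefoilGroup →* Matrix.SpecialLinearGroup (Fin 3) ℂ)
    (hP : ∀ s t : ℂ,
      ((P s t trefX : Matrix (Fin 3) (Fin 3) ℂ) = !![1, 0, 0; s, -1, 0; t, 0, -1]) ∧
      ((P s t trefY : Matrix (Fin 3) (Fin 3) ℂ) =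
        !![1, omg - 1, omg ^ 2 - 1; 0, omg, 0; 0, 0, omg ^ 2]))
    (ρ : TrefoilGroup →* Matrix.SpecialLinearGroup (Fin 3) ℂ)
    (hirr : ∀ W : Submodule ℂ (Fin 3 → ℂ),
      (∀ γ : TrefoilGroup, ∀ v ∈ W, (ρ γ : Matrix (Fin 3) (Fin 3) ℂ).mulVec v ∈ W) →
      W = ⊥ ∨ W = ⊤) :
    ∃ (s t : ℂ) (g : Matrix.SpecialLinearGroup (Fin 3) ℂ),
      ∀ γ : TrefoilGroup, ρ γ = g * P s t γ * g⁻¹ := by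
  set X : Matrix (Fin 3) (Fin 3) ℂ := (ρ trefX).1 with hX
  set Y : Matrix (Fin 3) (Fin 3) ℂ := (ρ trefY).1 with hY
  have hV : Module.finrank ℂ (Fin 3 → ℂ) = 3 := by simp
  have hw := omg_isPrimitiveRoot
  have hw3 : omg ^ 3 = 1 := hw.pow_eq_one
  have hw0 : 1 + omg + omg ^ 2 = 0 := by
    simpa [Finset.sum_range_succ] using hw.geom_sum_eq_zero (by norm_num)
  have hcommon : ∀ (v : Fin 3 → ℂ) (a b : ℂ), v ≠ 0 → X.mulVec v = a • v →
      Y.mulVec v = b • v → False := by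
    intro v a b hv hx hy
    rcases hirr (ℂ ∙ v) fun γ z hz => by
      obtain ⟨d, rfl⟩ := Submodule.mem_span_singleton.1 hz
      obtain ⟨c, hc⟩ := exists_mulVec_eq_smul ρ hv hx hy γ
      rw [Matrix.mulVec_smul, hc]
      exact Submodule.smul_mem _ _ (Submodule.smul_mem _ _ (Submodule.mem_span_singleton_self v))
      with h | h
    · exact hv (Submodule.span_singleton_eq_bot.1 h)
    · have h1 := finrank_span_singleton (K := ℂ) hv
      rw [h, finrank_top, hV] at h1
      norm_num at h1
  obtain ⟨c, hc⟩ := eq_smul_one_of_commute ρ hirr (X ^ 2) fun γ => by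
    simpa [Commute, SemiconjBy, hX] using congrArg
      (fun z => ((ρ z : Matrix.SpecialLinearGroup (Fin 3) ℂ) : Matrix (Fin 3) (Fin 3) ℂ))
      (trefX_sq_commute γ).eq
  have hXY : X ^ 2 = Y ^ 3 := by
    simpa [hX, hY] using congrArg
      (fun z => ((ρ z : Matrix.SpecialLinearGroup (Fin 3) ℂ) : Matrix (Fin 3) (Fin 3) ℂ))
      trefoil_relation
  have hX2 : ∀ v, X.toLin' (X.toLin' v) = c • v := fun v => by
    simpa [pow_two] using hc v
  have hY3 : ∀ v, Y.toLin' (Y.toLin' (Y.toLin' v)) = c • v := fun v => by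
    simpa [hXY, pow_succ, Matrix.mulVec_mulVec, mul_assoc] using hc v
  obtain ⟨a₀, ha₀⟩ := IsAlgClosed.exists_pow_nat_eq c (n := 2) (by norm_num)
  obtain ⟨a, ha, hrank⟩ := exists_rank_add_smul_le_one hV X.toLin' a₀ (by rwa [ha₀])
  rw [ha₀] at ha
  have hne : X.toLin' + a • LinearMap.id ≠ 0 := by
    intro h0
    obtain ⟨b, hb⟩ := Module.End.exists_eigenvalue Y.toLin'
    obtain ⟨v, hv⟩ := hb.exists_hasEigenvector
    refine hcommon v (-a) b hv.2 ?_ (by simpa using hv.apply_eq_smul)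
    rw [neg_smul, ← add_eq_zero_iff_eq_neg]
    simpa using LinearMap.congr_fun h0 v
  obtain ⟨u, φ, hu0, ⟨z, hz⟩, hφ⟩ := exists_dual_smul_of_finrank_range_le_one _ hrank hne
  have hXφ : ∀ v, X.mulVec v = φ v • u - a • v := fun v => by
    rw [← hφ]
    simp
  have hφu : φ u = 2 * a := by
    have h1 : X.mulVec u = a • u := by
      have h2 := hX2 z
      rw [← ha] at h2
      simp only [Matrix.toLin'_apply] at h2
      simp only [LinearMap.add_apply, LinearMap.smul_apply, LinearMap.id_apply,
        Matrix.toLin'_apply] at hz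
      rw [← hz, Matrix.mulVec_add, Matrix.mulVec_smul, h2]
      module
    rw [hXφ, sub_eq_iff_eq_add, ← add_smul] at h1
    rw [smul_left_injective ℂ hu0 h1]
    ring
  have hφ0 : ∀ (v : Fin 3 → ℂ) (b : ℂ), v ≠ 0 → Y.mulVec v = b • v → φ v ≠ 0 := by
    intro v b hv hb h
    refine hcommon v (-a) b hv ?_ hb
    rw [hXφ, h]
    simp
  have heig : ∀ p : ℂ, p ^ 3 = c → ∃ v ≠ 0, Y.mulVec v = p • v := fun p hp =>
    exists_eigenvector_of_cube hV Y.toLin' hw0 (by rwa [hp]) fun b =>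
      finrank_le_one_of_dual_ne_zero φ _ fun v hv hv0 =>
        hφ0 v b hv0 (by simpa [sub_eq_zero] using hv)
  have hinj : Function.Injective fun i : Fin 3 => omg ^ (i : ℕ) := fun i j hij =>
    Fin.ext (hw.pow_inj i.2 j.2 hij)
  have hc1 : c = 1 := by
    obtain ⟨p, hp⟩ := IsAlgClosed.exists_pow_nat_eq c (n := 3) (by norm_num)
    have hp0 : p ≠ 0 := by
      rintro rfl
      have hdet : (X ^ 2).det ≠ 0 := by
        rw [Matrix.det_pow, hX, Matrix.SpecialLinearGroup.det_coe]
        norm_num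
      exact hu0 (Matrix.eq_zero_of_mulVec_eq_zero hdet (by rw [hc, ← hp]; simp))
    choose v hv0 hv using fun i : Fin 3 => heig (p * omg ^ (i : ℕ)) (by
      rw [mul_pow, hp, ← pow_mul, mul_comm (i : ℕ), pow_mul, hw3, one_pow, mul_one])
    obtain ⟨hF, hYF⟩ := Matrix.det_ne_zero_and_mul_eq_mul_diagonal Y _
      (fun i j hij => hinj (mul_left_cancel₀ hp0 hij)) v hv0 hv
    have hdet := congrArg Matrix.det hYF
    rw [Matrix.det_mul, Matrix.det_mul, mul_comm] at hdet
    have h2 := mul_left_cancel₀ hF hdet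
    rw [hY, Matrix.SpecialLinearGroup.det_coe, Matrix.det_diagonal, Fin.prod_univ_three] at h2
    rw [← hp, h2]
    simp only [Fin.val_zero, Fin.val_one, Fin.val_two]
    linear_combination (-p ^ 3) * hw3
  subst hc1
  choose e he_ne he using fun i : Fin 3 => heig (omg ^ (i : ℕ)) (by
    rw [← pow_mul, mul_comm, pow_mul, hw3, one_pow])
  obtain ⟨v, hv0, hv, hφv⟩ : ∃ v : Fin 3 → Fin 3 → ℂ, (∀ i, v i ≠ 0) ∧
      (∀ i, Y.mulVec (v i) = omg ^ (i : ℕ) • v i) ∧ ∀ i, φ (v i) = 1 := by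
    have h0 := fun i => hφ0 _ _ (he_ne i) (he i)
    refine ⟨fun i => (φ (e i))⁻¹ • e i, fun i => smul_ne_zero (inv_ne_zero (h0 i)) (he_ne i),
      fun i => ?_, fun i => ?_⟩
    · rw [Matrix.mulVec_smul, he, smul_comm]
    · rw [map_smul, smul_eq_mul, inv_mul_cancel₀ (h0 i)]
  obtain ⟨hF, hYF⟩ := Matrix.det_ne_zero_and_mul_eq_mul_diagonal Y _ hinj v hv0 hv
  set F := (Matrix.of v).transpose with hFdef
  obtain ⟨k, hk⟩ : ∃ k, F.mulVec k = u :=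
    ⟨F⁻¹.mulVec u, by rw [Matrix.mulVec_mulVec, Matrix.mul_nonsing_inv _ hF.isUnit,
      Matrix.one_mulVec]⟩
  have huk : u = k 0 • v 0 + k 1 • v 1 + k 2 • v 2 := by
    rw [← hk]
    ext i
    simp [hFdef, Matrix.mulVec, dotProduct, Fin.sum_univ_three, mul_comm]
  have hksum : k 0 + k 1 + k 2 = 2 * a := by
    rw [← hφu, huk]
    simp [hφv]
  have hXF : X * F = F * (Matrix.vecMulVec k 1 - a • 1) := by
    rw [Matrix.mul_sub, Matrix.mul_vecMulVec, hk, Matrix.mul_smul, Matrix.mul_one]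
    ext i j
    have := congrFun (hXφ (v j)) i
    rw [hφv] at this
    simpa [hFdef, Matrix.mulVec, dotProduct, Matrix.mul_apply, Matrix.vecMulVec_apply] using this
  let U : Matrix (Fin 3) (Fin 3) ℂ := !![1, -1, -1; 0, 1, 0; 0, 0, 1]
  have hU : (F * U).det ≠ 0 := by
    rw [Matrix.det_mul, show U.det = 1 by simp [U, Matrix.det_fin_three], mul_one]
    exact hF
  have hXU : X * (F * U) = F * U * !![a, 0, 0; k 1, -a, 0; k 2, 0, -a] := by
    rw [← mul_assoc, hXF, mul_assoc, mul_assoc]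
    congr 1
    ext i j
    fin_cases i <;> fin_cases j <;>
      simp [U, Matrix.mul_apply, Fin.sum_univ_three, Matrix.one_apply]
    · linear_combination hksum
    · ring
    · ring
  have hYU : Y * (F * U) =
      F * U * !![1, omg - 1, omg ^ 2 - 1; 0, omg, 0; 0, 0, omg ^ 2] := by
    rw [← mul_assoc, hYF, mul_assoc, mul_assoc]
    congr 1
    ext i j
    fin_cases i <;> fin_cases j <;> simp [U, Matrix.mul_apply, Fin.sum_univ_three] <;> ring
  have ha1 : a = 1 := by
    have hdet := congrArg Matrix.det hXU
    rw [Matrix.det_mul, Matrix.det_mul _ (!![a, 0, 0; k 1, -a, 0; k 2, 0, -a]), mul_comm] at hdet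
    have h2 := mul_left_cancel₀ hU hdet
    rw [hX, Matrix.SpecialLinearGroup.det_coe] at h2
    simp [Matrix.det_fin_three] at h2
    linear_combination -h2 - a * ha
  subst ha1
  obtain ⟨g, hg⟩ := exists_specialLinearGroup_conj (F * U) hU
  refine ⟨k 1, k 2, g, fun γ => ?_⟩
  refine DFunLike.congr_fun (trefoil_hom_ext (φ := ρ)
    (ψ := (MulAut.conj g).toMonoidHom.comp (P (k 1) (k 2))) ?_ ?_) γ
  · exact hg _ _ (by rw [(hP _ _).1]; exact hXU)
  · exact hg _ _ (by rw [(hP _ _).2]; exact hYU)
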